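/- Let f(z) = ∑_{n≥1} a(n) e^{2πinz} be a nonzero cusp form of weight k for Γ₀(N) with real Fourier coefficients a(n). Then the sequence (a(n))_{n≥1} changes sign infinitely often: there are infinitely many n with a(n) > 0 and infinitely many n with a(n) < 0. -/

import Mathlib

open UpperHalfPlane Filter Topology

open scoped Pointwise in
/-- A cusp form for an arithmetic group tends to zero along the vertical geodesic ending at any
rational number. -/
theorem CuspForm.tendsto_vertical_rat {Γ : Subgroup (GL (Fin 2) ℝ)} [Γ.IsArithmetic] {k : ℤ}
    (f : CuspForm Γ k) (r : ℚ) :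
    Tendsto (fun t : ℝ ↦ f (ofComplex (r + t * Complex.I))) (𝓝[>] 0) (𝓝 0) := by
  obtain ⟨γ, hγ0, hγ1⟩ := (Int.isCoprime_iff_gcd_eq_one.mpr
    (show Int.gcd r.num r.den = 1 from r.reduced)).exists_SL2_col 0
  have hdet : (γ 0 0 : ℂ) * γ 1 1 - γ 0 1 * γ 1 0 = 1 := by
    have := γ.det_coe
    rw [Matrix.det_fin_two] at this
    exact_mod_cast this
  have hqC : (r.den : ℂ) ≠ 0 := by exact_mod_cast r.den_nz
  have hr : (r : ℂ) = r.num / r.den := by exact_mod_cast (Rat.num_div_den r).symm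
  rw [hγ0, hγ1] at hdet
  let g : GL (Fin 2) ℝ := Matrix.SpecialLinearGroup.mapGL ℝ γ
  let h := CuspForm.translate f g
  have : Subgroup.IsArithmetic (ConjAct.toConjAct g⁻¹ • Γ) := by
    simpa [g, show Rat.castHom ℝ = algebraMap ℚ ℝ from rfl, Matrix.SpecialLinearGroup.map_mapGL]
      using! Subgroup.IsArithmetic.conj Γ (Matrix.SpecialLinearGroup.mapGL ℚ γ)⁻¹
  obtain ⟨c, hc, hO⟩ := CuspFormClass.exp_decay_atImInfty' h
  obtain ⟨C, hC⟩ := hO.bound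
  obtain ⟨A, hA⟩ := (atImInfty_mem _).mp hC
  let u : ℝ → ℝ := fun t ↦ 1 / (r.den ^ 2 * t)
  have hu : Tendsto u (𝓝[>] 0) atTop := by
    have : Tendsto (fun t : ℝ ↦ (1 / (r.den : ℝ) ^ 2) * t⁻¹) (𝓝[>] 0) atTop :=
      tendsto_inv_nhdsGT_zero.const_mul_atTop (by positivity)
    refine this.congr fun t ↦ ?_
    simp only [u]
    rw [one_div, one_div, mul_inv]
  have hlim : Tendsto (fun t ↦ |C| * (r.den : ℝ) ^ k * (u t ^ (k : ℝ) * Real.exp (-c * u t)))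
      (𝓝[>] 0) (𝓝 0) := by
    simpa using ((tendsto_rpow_mul_exp_neg_mul_atTop_nhds_zero (k : ℝ) c hc).comp hu).const_mul
      (|C| * (r.den : ℝ) ^ k)
  refine squeeze_zero_norm' ?_ hlim
  filter_upwards [self_mem_nhdsWithin, hu.eventually_ge_atTop A] with t ht hAt
  have ht : 0 < t := ht
  have hut : 0 < u t := by simp only [u]; positivity
  let z : ℍ := ⟨-(γ 1 1 : ℂ) / r.den + u t * Complex.I, by
    have : (-(γ 1 1 : ℂ) / r.den) = ((-(γ 1 1 : ℝ) / r.den : ℝ) : ℂ) := by push_cast; rfl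
    rw [this]; simpa using hut⟩
  have hzim : z.im = u t := by
    have : (-(γ 1 1 : ℂ) / r.den) = ((-(γ 1 1 : ℝ) / r.den : ℝ) : ℂ) := by push_cast; rfl
    change (-(γ 1 1 : ℂ) / r.den + u t * Complex.I).im = _
    rw [this]; simp
  have hz : (r.den : ℂ) * z + γ 1 1 = r.den * u t * Complex.I := by
    change (r.den : ℂ) * (-(γ 1 1 : ℂ) / r.den + u t * Complex.I) + _ = _
    field_simp
    ring
  have hsmul : γ • z = ofComplex (r + t * Complex.I) := by
    rw [ofComplex_apply_of_im_pos (by simpa using ht)]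
    ext1
    rw [coe_specialLinearGroup_apply]
    simp only [algebraMap_int_eq, eq_intCast, hγ0, hγ1, Complex.ofReal_intCast, Int.cast_natCast,
      Complex.ofReal_natCast]
    rw [hz]
    have hutC : (u t : ℂ) = 1 / ((r.den : ℂ) ^ 2 * t) := by simp [u]
    have htC : (t : ℂ) ≠ 0 := by exact_mod_cast ht.ne'
    have hu0 : (u t : ℂ) ≠ 0 := by exact_mod_cast hut.ne'
    rw [div_eq_iff (by simp [hu0, r.den_nz])]
    change _ * (-(γ 1 1 : ℂ) / r.den + u t * Complex.I) + _ = _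
    rw [hr, hutC]
    field_simp
    push_cast at hdet
    linear_combination (-(r.den : ℂ) * t) * hdet - r.den * t * Complex.I_sq
  have hslash : h z = f (γ • z) * (r.den * u t * Complex.I) ^ (-k) := by
    change (SlashAction.map k γ (f : ℍ → ℂ)) z = _
    rw [ModularForm.SL_slash_apply, ModularGroup.denom_apply, hγ1, ← hz]
    simp
  have hnorm : ‖f (γ • z)‖ = ‖h z‖ * ((r.den : ℝ) ^ k * u t ^ k) := by
    rw [hslash, norm_mul, norm_zpow]
    simp only [Complex.norm_mul, Complex.norm_natCast, Complex.norm_real, Complex.norm_I, mul_one,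
      Real.norm_eq_abs, abs_of_pos hut]
    rw [← mul_zpow, mul_assoc, ← zpow_add₀ (by positivity)]
    simp
  rw [← hsmul, hnorm, Real.rpow_intCast]
  have hb : ‖h z‖ ≤ |C| * Real.exp (-c * u t) := by
    refine (hA z (hzim ▸ hAt)).trans ?_
    rw [hzim, Real.norm_eq_abs, Real.abs_exp]
    gcongr
    exact le_abs_self C
  calc _ ≤ |C| * Real.exp (-c * u t) * ((r.den : ℝ) ^ k * u t ^ k) := by gcongr
    _ = _ := by ring

/-- A power series without constant term and with absolutely summable coefficients which tends
radially to zero at all roots of unity vanishes on the open unit disc. -/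
theorem tsum_pow_eq_zero_of_tendsto_vertical_rat {b : ℕ → ℂ} (hb : Summable fun n ↦ ‖b n‖)
    (h : ∀ r : ℚ, Tendsto (fun t : ℝ ↦ ∑' n, b n *
      Complex.exp (2 * Real.pi * Complex.I * (r + t * Complex.I)) ^ (n + 1)) (𝓝[>] 0) (𝓝 0))
    {w : ℂ} (hw : ‖w‖ < 1) : ∑' n, b n * w ^ (n + 1) = 0 := by
  let G : ℂ → ℂ := fun w ↦ ∑' n, b n * w ^ (n + 1)
  have hbound : ∀ (n : ℕ), ∀ w ∈ Metric.closedBall (0 : ℂ) 1, ‖b n * w ^ (n + 1)‖ ≤ ‖b n‖ := by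
    intro n w hw
    rw [norm_mul, norm_pow]
    exact mul_le_of_le_one_right (norm_nonneg _)
      (pow_le_one₀ (norm_nonneg _) (by simpa using hw))
  have hcont : ContinuousOn G (Metric.closedBall 0 1) :=
    continuousOn_tsum (fun n ↦ by fun_prop) hb hbound
  have hdiff : DifferentiableOn ℂ G (Metric.ball 0 1) :=
    Complex.differentiableOn_tsum_of_summable_norm hb (fun n ↦ by fun_prop) Metric.isOpen_ball
      fun n w hw ↦ hbound n w (Metric.ball_subset_closedBall hw)
  let e : ℂ → ℂ := fun z ↦ Complex.exp (2 * Real.pi * Complex.I * z)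
  have hmem : ∀ z : ℂ, 0 ≤ z.im → e z ∈ Metric.closedBall (0 : ℂ) 1 := by
    intro z hz
    simp only [e, mem_closedBall_zero_iff, Complex.norm_exp, Real.exp_le_one_iff]
    simp only [Complex.mul_re, Complex.mul_im, Complex.re_ofNat, Complex.im_ofNat,
      Complex.ofReal_re, Complex.ofReal_im, Complex.I_re, Complex.I_im]
    have := mul_nonneg Real.pi_pos.le hz
    linarith
  have hecont : Continuous e := by fun_prop
  have hcomp : ContinuousOn (G ∘ e) {z | 0 ≤ z.im} := hcont.comp hecont.continuousOn hmem
  have hrat : ∀ r : ℚ, G (e ((r : ℝ) : ℂ)) = 0 := by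
    intro r
    have h1 : Tendsto (fun t : ℝ ↦ (r : ℂ) + t * Complex.I) (𝓝[>] 0)
        (𝓝[{z | 0 ≤ z.im}] ((r : ℝ) : ℂ)) := by
      refine tendsto_nhdsWithin_iff.mpr ⟨?_, ?_⟩
      · refine tendsto_nhdsWithin_of_tendsto_nhds ?_
        have : Continuous fun t : ℝ ↦ (r : ℂ) + t * Complex.I := by fun_prop
        simpa using this.tendsto 0
      · filter_upwards [self_mem_nhdsWithin] with t ht
        simpa using (show 0 < t from ht).le
    exact tendsto_nhds_unique ((hcomp ((r : ℝ) : ℂ) (by simp)).tendsto.comp h1) (h r)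
  have hreal : (fun x : ℝ ↦ G (e x)) = fun _ ↦ 0 := by
    refine Continuous.ext_on Rat.isDenseEmbedding_coe_real.dense ?_ continuous_const ?_
    · exact hcomp.comp_continuous Complex.continuous_ofReal (by simp)
    · rintro _ ⟨r, rfl⟩
      exact hrat r
  have := Complex.eqOn_of_eqOn_frontier (f := G) (g := fun _ ↦ 0) (U := Metric.ball 0 1)
    Metric.isBounded_ball ⟨hdiff, by rwa [closure_ball _ one_ne_zero]⟩ diffContOnCl_const
    (fun w hw ↦ by
      rw [frontier_ball _ one_ne_zero, mem_sphere_zero_iff_norm] at hw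
      have hwe : w = e ((Complex.arg w / (2 * Real.pi) : ℝ) : ℂ) := by
        conv_lhs => rw [← Complex.norm_mul_exp_arg_mul_I w, hw]
        simp only [e]
        push_cast
        rw [one_mul]
        congr 1
        have : (Real.pi : ℂ) ≠ 0 := by exact_mod_cast Real.pi_ne_zero
        field_simp
      rw [hwe]
      exact congrFun hreal _)
  exact this (mem_ball_zero_iff.mpr hw)

open scoped Manifold in
/-- If a nonzero holomorphic function on the upper half-plane is pointwise the `tsum`
of a Fourier series, then that series converges absolutely everywhere. -/
theorem UpperHalfPlane.summable_of_eq_tsum {f : ℍ → ℂ} (hf : MDiff f) (hf0 : ∃ z, f z ≠ 0)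
    {b : ℕ → ℂ}
    (hcoef : ∀ z : ℍ, f z = ∑' n, b n * Complex.exp (2 * Real.pi * Complex.I * z) ^ (n + 1))
    {y : ℝ} (hy : 0 < y) :
    Summable fun n ↦ ‖b n‖ * Real.exp (-2 * Real.pi * y) ^ (n + 1) := by
  by_contra hns
  obtain ⟨z₀, hz₀⟩ := hf0
  have hnorm (z : ℍ) : ‖Complex.exp (2 * Real.pi * Complex.I * z)‖
      = Real.exp (-2 * Real.pi * z.im) := by
    rw [Complex.norm_exp]
    simp
  have hzero : ∀ z : ℍ, z.im < y → f z = 0 := by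
    intro z hz
    rw [hcoef, tsum_eq_zero_of_not_summable]
    intro hs
    refine hns (hs.norm.of_nonneg_of_le (fun n ↦ by positivity) fun n ↦ ?_)
    rw [norm_mul, norm_pow, hnorm]
    gcongr ‖b n‖ * ?_ ^ _
    rw [Real.exp_le_exp]
    nlinarith [Real.pi_pos]
  have hU : IsOpen {z : ℂ | 0 < z.im} := isOpen_lt continuous_const Complex.continuous_im
  have han : AnalyticOnNhd ℂ (f ∘ ofComplex) {z | 0 < z.im} :=
    (mdifferentiable_iff.mp hf).analyticOnNhd hU
  have hev : (f ∘ ofComplex) =ᶠ[𝓝 ((y / 2 : ℝ) * Complex.I)] 0 := by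
    have hV : IsOpen {z : ℂ | 0 < z.im ∧ z.im < y} :=
      hU.inter (isOpen_lt Complex.continuous_im continuous_const)
    filter_upwards [hV.mem_nhds (by simpa using hy)] with z hz
    simp only [Function.comp_apply, ofComplex_apply_of_im_pos hz.1, Pi.zero_apply]
    exact hzero _ hz.2
  have := han.eqOn_zero_of_preconnected_of_eventuallyEq_zero
    (convex_halfSpace_im_gt 0).isPreconnected (by simpa using hy) hev z₀.im_pos
  exact hz₀ (by simpa using this)

/-- A cusp form for an arithmetic group which is the sum of a Fourier series with real, eventually
nonnegative coefficients is zero. -/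
theorem CuspForm.eq_zero_of_eventually_nonneg {Γ : Subgroup (GL (Fin 2) ℝ)} [Γ.IsArithmetic]
    {k : ℤ} (f : CuspForm Γ k) {a : ℕ → ℝ}
    (hcoef : ∀ z : ℍ, f z = ∑' n : ℕ, (a (n + 1) : ℂ) *
        Complex.exp (2 * Real.pi * Complex.I * ((n : ℂ) + 1) * (z : ℂ)))
    (ha : ∀ᶠ n in atTop, 0 ≤ a n) (z : ℍ) : f z = 0 := by
  by_contra hz
  have hcoef' : ∀ z : ℍ, f z = ∑' n : ℕ, (a (n + 1) : ℂ) *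
      Complex.exp (2 * Real.pi * Complex.I * z) ^ (n + 1) := by
    intro z
    rw [hcoef]
    refine tsum_congr fun n ↦ ?_
    rw [← Complex.exp_nat_mul]
    push_cast
    ring_nf
  have hsum {y : ℝ} (hy : 0 < y) :=
    UpperHalfPlane.summable_of_eq_tsum f.holo' ⟨z, hz⟩ hcoef' hy
  obtain ⟨M, hM⟩ := eventually_atTop.mp ha
  let E : ℝ → ℝ := fun t ↦ Real.exp (-2 * Real.pi * t)
  have hE : ∀ t : ℝ, Complex.exp (2 * Real.pi * Complex.I * (t * Complex.I)) = (E t : ℂ) := by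
    intro t
    simp only [E, Complex.ofReal_exp]
    congr 1
    push_cast
    linear_combination (2 * Real.pi * t : ℂ) * Complex.I_sq
  have hf_re {t : ℝ} (ht : 0 < t) :
      f (ofComplex (t * Complex.I)) = ((∑' n, a (n + 1) * E t ^ (n + 1) : ℝ) : ℂ) := by
    rw [hcoef', ofComplex_apply_of_im_pos (by simpa using ht)]
    simp only [hE, Complex.ofReal_tsum]
    push_cast
    rfl
  have hlim : Tendsto (fun t : ℝ ↦ ∑' n, a (n + 1) * E t ^ (n + 1)) (𝓝[>] 0) (𝓝 0) := by
    have h := f.tendsto_vertical_rat 0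
    have h2 := (Complex.continuous_re.tendsto 0).comp h
    refine h2.congr' ?_
    filter_upwards [self_mem_nhdsWithin] with t ht
    simp [hf_re ht]
  have hEcont : Tendsto E (𝓝[>] 0) (𝓝 1) := by
    have : Continuous E := by fun_prop
    simpa [E] using (this.tendsto 0).mono_left nhdsWithin_le_nhds
  have habs : Summable fun n ↦ a (n + 1) := by
    rw [← summable_nat_add_iff M]
    refine summable_of_sum_range_le (c := 0 - ∑ n ∈ Finset.range M, a (n + 1) * 1 ^ (n + 1))
      (fun n ↦ hM _ (by omega)) fun K ↦ ?_
    have hl : Tendsto (fun t ↦ ∑ n ∈ Finset.range K, a (n + M + 1) * E t ^ (n + M + 1)) (𝓝[>] 0)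
        (𝓝 (∑ n ∈ Finset.range K, a (n + M + 1) * 1 ^ (n + M + 1))) :=
      tendsto_finsetSum _ fun n _ ↦ (hEcont.pow _).const_mul _
    have hr := hlim.sub (tendsto_finsetSum (Finset.range M)
      fun n _ ↦ (hEcont.pow (n + 1)).const_mul (a (n + 1)))
    have key := le_of_tendsto_of_tendsto hl hr ?_
    · simpa using key
    filter_upwards [self_mem_nhdsWithin] with t ht
    have hs : Summable fun n ↦ a (n + 1) * E t ^ (n + 1) := by
      refine Summable.of_norm ((hsum ht).congr fun n ↦ ?_)
      rw [norm_mul, norm_pow, Real.norm_of_nonneg (Real.exp_pos _).le]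
      simp
    rw [← hs.sum_add_tsum_nat_add M, add_sub_cancel_left]
    exact ((summable_nat_add_iff M).mpr hs).sum_le_tsum _ fun n _ ↦
      mul_nonneg (hM _ (by omega)) (pow_nonneg (Real.exp_pos _).le _)
  have hb : Summable fun n ↦ ‖(a (n + 1) : ℂ)‖ := by
    simpa using habs.norm
  refine hz ?_
  rw [hcoef']
  refine tsum_pow_eq_zero_of_tendsto_vertical_rat hb (fun r ↦ ?_) ?_
  · refine (f.tendsto_vertical_rat r).congr' ?_
    filter_upwards [self_mem_nhdsWithin] with t ht
    rw [hcoef', ofComplex_apply_of_im_pos (by simpa using ht)]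
  · rw [Complex.norm_exp, Real.exp_lt_one_iff]
    have := mul_pos Real.pi_pos z.im_pos
    simp
    linarith

/-- Proposition 4.1: a nonzero cusp form of weight `k` for `Γ₀(N)` with real Fourier
coefficients `a(n)` has infinitely many sign changes among its coefficients. -/
theorem stmt16 (N : ℕ) (hN : 0 < N) (k : ℤ)
    (f : CuspForm (CongruenceSubgroup.Gamma0 N) k)
    (hf0 : ∃ z : UpperHalfPlane, f z ≠ 0)
    (a : ℕ → ℝ)
    (hcoef : ∀ z : UpperHalfPlane,
      f z = ∑' n : ℕ, (a (n + 1) : ℂ) *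
        Complex.exp (2 * Real.pi * Complex.I * ((n : ℂ) + 1) * (z : ℂ))) :
    {n : ℕ | 0 < a n}.Infinite ∧ {n : ℕ | a n < 0}.Infinite := by
  have : NeZero N := ⟨hN.ne'⟩
  obtain ⟨z, hz⟩ := hf0
  constructor
  · intro hfin
    refine hz (neg_eq_zero.mp ((-f).eq_zero_of_eventually_nonneg (a := fun n ↦ -a n)
      (fun z ↦ ?_) ?_ z))
    · simp [hcoef, tsum_neg]
    · rw [← Nat.cofinite_eq_atTop]
      filter_upwards [hfin.compl_mem_cofinite] with n hn
      simpa using hn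
  · intro hfin
    refine hz (f.eq_zero_of_eventually_nonneg hcoef ?_ z)
    rw [← Nat.cofinite_eq_atTop]
    filter_upwards [hfin.compl_mem_cofinite] with n hn
    simpa using hn
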